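/- arXiv:2501.03157 — 4 statements merged into one kernel-verified Lean document; each statement's English description precedes it below -/
import Mathlib

section
/- Let V : ℤ → ℝ be a bounded potential and let H be the discrete Schrödinger operator (Hu)(k) = u(k+1) + u(k-1) + V(k)u(k) on ℓ²(ℤ). Suppose V has γ-repetitions for some γ > 0, i.e., there exists a sequence (k_n) with k_n → +∞ (or k_n → -∞) such that |V(k_n + k) - V(k)| ≤ e^{-γ|k_n|} for all k ∈ ℤ and all n. If E ∈ ℂ satisfies γ > 𝓛(E), then the eigen-equation Hu = Eu has no nonzero solution u ∈ ℓ²(ℤ). -/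
open Filter Matrix

noncomputable section

attribute [local instance] Matrix.linftyOpNormedRing

/-- One-step transfer matrix `A_k(E)`. -/
def oneStep (V : ℤ → ℝ) (E : ℂ) (k : ℤ) : Matrix (Fin 2) (Fin 2) ℂ :=
  !![E - (V k : ℂ), -1; 1, 0]

/-- For `j ≤ k`, the product `A_{k-1}(E) A_{k-2}(E) ⋯ A_j(E)`. -/
def transferFwd (V : ℤ → ℝ) (E : ℂ) (k j : ℤ) : Matrix (Fin 2) (Fin 2) ℂ :=
  (((List.range (k - j).toNat).map fun i => oneStep V E (k - 1 - i)).prod)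

/-- Multi-step transfer matrix `A_{k,j}(E)`. -/
def transfer (V : ℤ → ℝ) (E : ℂ) (k j : ℤ) : Matrix (Fin 2) (Fin 2) ℂ :=
  if j ≤ k then transferFwd V E k j else (transferFwd V E j k)⁻¹

/-- `𝓛(E) = limsup_{k→∞} sup_{j∈ℤ} ln‖A_{k+j,j}(E)‖ / k`, as an extended real number. -/
def transferExp (V : ℤ → ℝ) (E : ℂ) : EReal :=
  Filter.limsup
    (fun k : ℕ => ⨆ j : ℤ, ((Real.log ‖transfer V E ((k : ℤ) + j) j‖ / (k : ℝ) : ℝ) : EReal))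
    Filter.atTop

/-- `β(α) = limsup_{k→∞} (-ln ‖kα‖_𝕋)/k`, where `‖x‖_𝕋 = dist(x, ℤ)`. -/
def beta (α : ℝ) : EReal :=
  Filter.limsup
    (fun k : ℕ => (((-Real.log |(k : ℝ) * α - round ((k : ℝ) * α)|) / (k : ℝ) : ℝ) : EReal))
    Filter.atTop


/-- The product of `k` consecutive one-step matrices starting at site `j`. -/
def stepProd (V : ℤ → ℝ) (E : ℂ) : ℕ → ℤ → Matrix (Fin 2) (Fin 2) ℂ
  | 0, _ => 1
  | k + 1, j => oneStep V E (j + k) * stepProd V E k j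

/-- The vector `(u k, u (k - 1))` on which the transfer matrices act. -/
def stateVec (u : ℤ → ℂ) (k : ℤ) : Fin 2 → ℂ := ![u k, u (k - 1)]

theorem transferFwd_succ (V : ℤ → ℝ) (E : ℂ) (k : ℕ) (j : ℤ) :
    transferFwd V E (((k + 1 : ℕ) : ℤ) + j) j
      = oneStep V E (j + k) * transferFwd V E ((k : ℤ) + j) j := by
  have h1 : ((((k + 1 : ℕ) : ℤ) + j) - j).toNat = k + 1 := by omega
  have h2 : (((k : ℤ) + j) - j).toNat = k := by omega
  simp only [transferFwd, List.bind_eq_flatMap, List.pure_def, ← List.map_eq_flatMap,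
    List.map_map]
  rw [h1, h2, List.range_succ_eq_map, List.map_cons, List.prod_cons, List.map_map]
  refine congrArg₂ (fun M l => M * List.prod l) ?_
    (congrArg (fun f => List.map f (List.range k)) (funext fun i => ?_))
  all_goals
    refine congrArg (oneStep V E) ?_
    push_cast
    ring

theorem transfer_eq_stepProd (V : ℤ → ℝ) (E : ℂ) (k : ℕ) (j : ℤ) :
    transfer V E ((k : ℤ) + j) j = stepProd V E k j := by
  rw [transfer, if_pos (by omega)]
  induction k with
  | zero => simp [transferFwd, stepProd]
  | succ k ih => rw [transferFwd_succ, ih, stepProd]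

theorem stepProd_succ_right (V : ℤ → ℝ) (E : ℂ) (k : ℕ) (j : ℤ) :
    stepProd V E (k + 1) j = stepProd V E k (j + 1) * oneStep V E j := by
  induction k with
  | zero => simp [stepProd]
  | succ k ih =>
    have h : j + ((k + 1 : ℕ) : ℤ) = j + 1 + k := by push_cast; ring
    rw [stepProd, ih, stepProd, h, mul_assoc]

theorem det_stepProd (V : ℤ → ℝ) (E : ℂ) (k : ℕ) (j : ℤ) : (stepProd V E k j).det = 1 := by
  induction k with
  | zero => simp [stepProd]
  | succ k ih => rw [stepProd, det_mul, ih]; simp [oneStep, det_fin_two]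

theorem stepProd_mulVec_stateVec {V : ℤ → ℝ} {E : ℂ} {u : ℤ → ℂ}
    (hsol : ∀ k : ℤ, u (k + 1) + u (k - 1) + (V k : ℂ) * u k = E * u k) (k : ℕ) (j : ℤ) :
    stepProd V E k j *ᵥ stateVec u j = stateVec u (j + k) := by
  induction k with
  | zero => simp [stepProd]
  | succ k ih =>
    have h : j + ((k + 1 : ℕ) : ℤ) = j + k + 1 := by push_cast; ring
    rw [stepProd, ← mulVec_mulVec, ih, h]
    ext i
    fin_cases i
    · simp [oneStep, stateVec]
      linear_combination -hsol (j + k)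
    · simp [oneStep, stateVec]

theorem mul_self_fin_two_of_det_eq_one {R : Type*} [CommRing R] {M : Matrix (Fin 2) (Fin 2) R}
    (h : M.det = 1) : M * M = M.trace • M - 1 := by
  rw [det_fin_two] at h
  ext i j
  fin_cases i <;> fin_cases j <;>
    simp [mul_apply, trace_fin_two, Fin.sum_univ_two] <;>
    first | ring1 | linear_combination -h

theorem norm_entry_le (M : Matrix (Fin 2) (Fin 2) ℂ) (i j : Fin 2) : ‖M i j‖ ≤ ‖M‖ := by
  have h : ‖M i j‖₊ ≤ ‖M‖₊ := by
    rw [linfty_opNNNorm_def]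
    exact (Finset.single_le_sum (f := fun j => ‖M i j‖₊) (fun _ _ => zero_le)
      (Finset.mem_univ j)).trans
      (Finset.le_sup (f := fun i => ∑ j, ‖M i j‖₊) (Finset.mem_univ i))
  exact h

theorem norm_trace_fin_two_le (M : Matrix (Fin 2) (Fin 2) ℂ) : ‖M.trace‖ ≤ 2 * ‖M‖ := by
  rw [trace_fin_two]
  linarith [norm_add_le (M 0 0) (M 1 1), norm_entry_le M 0 0, norm_entry_le M 1 1]

theorem norm_fin_two_le {M : Matrix (Fin 2) (Fin 2) ℂ} {c : ℝ}
    (h : ∀ i, ‖M i 0‖ + ‖M i 1‖ ≤ c) : ‖M‖ ≤ c := by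
  have hc : 0 ≤ c := (by positivity : 0 ≤ ‖M 0 0‖ + ‖M 0 1‖).trans (h 0)
  lift c to NNReal using hc
  have : ‖M‖₊ ≤ c := by
    rw [linfty_opNNNorm_def]
    refine Finset.sup_le fun i _ => ?_
    rw [Fin.sum_univ_two]
    exact_mod_cast h i
  exact_mod_cast this

theorem norm_oneStep_le {V : ℤ → ℝ} {B : ℝ} (hV : ∀ k, |V k| ≤ B) (E : ℂ) (k : ℤ) :
    ‖oneStep V E k‖ ≤ ‖E‖ + B + 1 := by
  have hVk := hV k
  have hsub := norm_sub_le E (V k : ℂ)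
  rw [Complex.norm_real, Real.norm_eq_abs] at hsub
  refine norm_fin_two_le fun i => ?_
  fin_cases i
  · simp [oneStep]
    linarith
  · simp [oneStep]
    linarith [norm_nonneg E, abs_nonneg (V k)]

theorem norm_oneStep_sub_le (V : ℤ → ℝ) (E : ℂ) (k l : ℤ) :
    ‖oneStep V E k - oneStep V E l‖ ≤ |V k - V l| := by
  refine norm_fin_two_le fun i => ?_
  fin_cases i
  · simp [oneStep]
    rw [← Complex.ofReal_sub, Complex.norm_real, Real.norm_eq_abs, abs_sub_comm]
  · simp [oneStep]

theorem norm_stepProd_le_pow {V : ℤ → ℝ} {E : ℂ} {R : ℝ}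
    (h : ∀ k, ‖oneStep V E k‖ ≤ R) (k : ℕ) (j : ℤ) : ‖stepProd V E k j‖ ≤ R ^ k := by
  induction k with
  | zero =>
    refine norm_fin_two_le fun i => ?_
    fin_cases i <;> simp [stepProd, one_apply]
  | succ k ih =>
    rw [stepProd, pow_succ']
    exact (norm_mul_le _ _).trans
      (mul_le_mul (h _) ih (norm_nonneg _) ((norm_nonneg _).trans (h 0)))

/-- Telescoping bound for the change of a transfer matrix under a translation of the potential. -/
theorem norm_mul_stepProd_sub_le {V : ℤ → ℝ} {E : ℂ} {C L δ : ℝ} (hL : 0 ≤ L)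
    (hC : ∀ (k : ℕ) (j : ℤ), ‖stepProd V E k j‖ ≤ C * Real.exp (L * k))
    {x j : ℤ} (hδ : ∀ i : ℕ, |V (x + i) - V (j + i)| ≤ δ) (k m : ℕ) :
    ‖stepProd V E m (x + k) * (stepProd V E k x - stepProd V E k j)‖
      ≤ k * C ^ 2 * Real.exp (L * (m + k)) * δ := by
  have hC0 : 0 ≤ C := by simpa using (norm_nonneg _).trans (hC 0 0)
  have hδ0 : 0 ≤ δ := (abs_nonneg _).trans (hδ 0)
  induction k generalizing m with
  | zero => simp [stepProd]
  | succ k ih =>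
    have hx : x + ((k + 1 : ℕ) : ℤ) = x + k + 1 := by push_cast; ring
    have hsplit : stepProd V E m (x + k + 1) * (stepProd V E (k + 1) x - stepProd V E (k + 1) j)
        = stepProd V E (m + 1) (x + k) * (stepProd V E k x - stepProd V E k j)
          + stepProd V E m (x + k + 1) * (oneStep V E (x + k) - oneStep V E (j + k))
            * stepProd V E k j := by
      rw [stepProd_succ_right V E m, stepProd, stepProd]
      noncomm_ring
    have h1 := ih (m + 1)
    have h2 : ‖stepProd V E m (x + k + 1) * (oneStep V E (x + k) - oneStep V E (j + k))
        * stepProd V E k j‖ ≤ C * Real.exp (L * m) * δ * (C * Real.exp (L * k)) := by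
      refine (norm_mul_le _ _).trans (mul_le_mul ((norm_mul_le _ _).trans ?_) (hC _ _)
        (norm_nonneg _) (by positivity))
      exact mul_le_mul (hC _ _) ((norm_oneStep_sub_le V E _ _).trans (hδ k))
        (norm_nonneg _) (by positivity)
    have h3 : C * Real.exp (L * m) * δ * (C * Real.exp (L * k))
        ≤ C ^ 2 * Real.exp (L * (m + 1 + k)) * δ := by
      have : Real.exp (L * m) * Real.exp (L * k) ≤ Real.exp (L * (m + 1 + k)) := by
        rw [← Real.exp_add]
        exact Real.exp_le_exp.mpr (by linarith)
      calc _ = C ^ 2 * (Real.exp (L * m) * Real.exp (L * k)) * δ := by ring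
        _ ≤ _ := by gcongr
    rw [hx, hsplit]
    refine (norm_add_le _ _).trans ((add_le_add h1 (h2.trans h3)).trans_eq ?_)
    push_cast
    ring_nf

theorem norm_stepProd_sub_le {V : ℤ → ℝ} {E : ℂ} {C L δ : ℝ} (hL : 0 ≤ L)
    (hC : ∀ (k : ℕ) (j : ℤ), ‖stepProd V E k j‖ ≤ C * Real.exp (L * k))
    {x j : ℤ} (hδ : ∀ i : ℕ, |V (x + i) - V (j + i)| ≤ δ) (k : ℕ) :
    ‖stepProd V E k x - stepProd V E k j‖ ≤ k * C ^ 2 * Real.exp (L * k) * δ := by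
  simpa [stepProd] using norm_mul_stepProd_sub_le hL hC hδ k 0

/-- Above the uniform exponent, transfer matrices are exponentially bounded. -/
theorem exists_norm_stepProd_le {V : ℤ → ℝ} (hV : ∃ M : ℝ, ∀ k : ℤ, |V k| ≤ M) {E : ℂ} {L : ℝ}
    (hL : 0 ≤ L) (hE : transferExp V E < (L : EReal)) :
    ∃ C : ℝ, ∀ (k : ℕ) (j : ℤ), ‖stepProd V E k j‖ ≤ C * Real.exp (L * k) := by
  obtain ⟨B, hB⟩ := hV
  have hR := norm_oneStep_le hB E
  set R := ‖E‖ + B + 1 with hRdef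
  have hR1 : 1 ≤ R := by
    linarith [norm_nonneg E, (abs_nonneg _).trans (hB 0)]
  obtain ⟨K, hK⟩ := eventually_atTop.mp
    ((eventually_lt_of_limsup_lt hE).and (eventually_gt_atTop 0))
  refine ⟨R ^ K, fun k j => ?_⟩
  have hexp : 1 ≤ Real.exp (L * k) := Real.one_le_exp (by positivity)
  have hRK : 1 ≤ R ^ K := one_le_pow₀ hR1
  rcases lt_or_ge k K with hk | hk
  · calc ‖stepProd V E k j‖ ≤ R ^ k := norm_stepProd_le_pow hR k j
      _ ≤ R ^ K := pow_le_pow_right₀ hR1 hk.le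
      _ ≤ R ^ K * Real.exp (L * k) := le_mul_of_one_le_right (by positivity) hexp
  · obtain ⟨h1, h2⟩ := hK k hk
    have h3 := (le_iSup (fun j : ℤ =>
      ((Real.log ‖transfer V E ((k : ℤ) + j) j‖ / (k : ℝ) : ℝ) : EReal)) j).trans h1.le
    rw [EReal.coe_le_coe_iff, transfer_eq_stepProd, div_le_iff₀ (by exact_mod_cast h2)] at h3
    calc ‖stepProd V E k j‖ ≤ Real.exp (Real.log ‖stepProd V E k j‖) := Real.le_exp_log _
      _ ≤ Real.exp (L * k) := Real.exp_le_exp.mpr h3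
      _ ≤ R ^ K * Real.exp (L * k) := le_mul_of_one_le_left (by positivity) hRK

theorem tendsto_cofinite_of_summable_norm_sq {u : ℤ → ℂ} (hl2 : Summable fun k => ‖u k‖ ^ 2) :
    Tendsto u cofinite (nhds 0) := by
  have h := hl2.tendsto_cofinite_zero.sqrt
  simp only [Real.sqrt_zero, Real.sqrt_sq (norm_nonneg _)] at h
  exact tendsto_zero_iff_norm_tendsto_zero.mpr h

theorem tendsto_stateVec {u : ℤ → ℂ} (hu : Tendsto u cofinite (nhds 0)) :
    Tendsto (stateVec u) cofinite (nhds 0) := by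
  refine tendsto_pi_nhds.mpr fun i => ?_
  fin_cases i
  · simpa [stateVec] using hu
  · simpa [stateVec, Function.comp_def] using
      hu.comp (sub_left_injective (b := (1 : ℤ))).tendsto_cofinite

theorem eq_zero_of_stateVec_zero {V : ℤ → ℝ} {E : ℂ} {u : ℤ → ℂ}
    (hsol : ∀ k : ℤ, u (k + 1) + u (k - 1) + (V k : ℂ) * u k = E * u k)
    (h0 : stateVec u 0 = 0) : u = 0 := by
  have key : ∀ k : ℤ, u k = 0 ∧ u (k - 1) = 0 := by
    intro k
    induction k using Int.induction_on with
    | zero =>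
      exact ⟨by simpa [stateVec] using congrFun h0 0, by simpa [stateVec] using congrFun h0 1⟩
    | succ i ih =>
      have h := hsol i
      rw [ih.1, ih.2] at h
      exact ⟨by simpa using h, by simpa using ih.1⟩
    | pred i ih =>
      have h := hsol (-i - 1)
      rw [sub_add_cancel, ih.1, ih.2] at h
      exact ⟨ih.2, by simpa using h⟩
  exact funext fun k => (key k).1

/-- Three-block Gordon argument along periods `p n → ∞`. -/
theorem stateVec_zero_eq_zero {V : ℤ → ℝ} {E : ℂ} {u : ℤ → ℂ} {p : ℕ → ℕ}
    (hsol : ∀ k : ℤ, u (k + 1) + u (k - 1) + (V k : ℂ) * u k = E * u k)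
    (hu : Tendsto (stateVec u) cofinite (nhds 0)) (hp : Tendsto p atTop atTop)
    (hA : Tendsto (fun n => ‖stepProd V E (p n) (p n) - stepProd V E (p n) 0‖) atTop (nhds 0))
    (hB : Tendsto (fun n => ‖stepProd V E (p n) 0 - stepProd V E (p n) (-p n)‖) atTop (nhds 0)) :
    stateVec u 0 = 0 := by
  have hpZ : Tendsto (fun n => (p n : ℤ)) atTop atTop := tendsto_natCast_atTop_atTop.comp hp
  have hU : ∀ {f : ℕ → ℤ}, Tendsto f atTop (atBot ⊔ atTop) →
      Tendsto (fun n => stateVec u (f n)) atTop (nhds 0) := fun hf =>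
    hu.comp (by rwa [Int.cofinite_eq])
  have hU1 := hU (hpZ.mono_right le_sup_right)
  have hUm := hU ((tendsto_neg_atTop_atBot.comp hpZ).mono_right le_sup_left)
  have hU2 := hU ((hpZ.atTop_add_atTop hpZ).mono_right le_sup_right)
  have hmul : ∀ {M : ℕ → Matrix (Fin 2) (Fin 2) ℂ} {w : ℕ → Fin 2 → ℂ} {c : ℝ},
      Tendsto (fun n => ‖M n‖) atTop (nhds 0) → Tendsto (fun n => ‖w n‖) atTop (nhds c) →
      Tendsto (fun n => M n *ᵥ w n) atTop (nhds 0) := fun {M w c} hM hw =>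
    squeeze_zero_norm (fun n => linfty_opNorm_mulVec (M n) (w n)) (by simpa using hM.mul hw)
  have hcayley : ∀ (k : ℕ) (j : ℤ) (w : Fin 2 → ℂ),
      stepProd V E k j *ᵥ (stepProd V E k j *ᵥ w)
        = (stepProd V E k j).trace • (stepProd V E k j *ᵥ w) - w := fun k j w => by
    rw [mulVec_mulVec, mul_self_fin_two_of_det_eq_one (det_stepProd V E k j), sub_mulVec,
      smul_mulVec, one_mulVec]
  by_contra hne
  -- The trace over the block ending at `0` tends to zero.
  have hleft : Tendsto (fun n => (stepProd V E (p n) (-p n)).trace • stateVec u 0)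
      atTop (nhds 0) := by
    have h := (hU1.sub (hmul hB (tendsto_const_nhds (x := ‖stateVec u 0‖)))).add hUm
    simp only [sub_zero, add_zero] at h
    refine h.congr fun n => ?_
    have h1 := hcayley (p n) (-p n) (stateVec u (-p n))
    have h2 := stepProd_mulVec_stateVec hsol (p n) 0
    rw [stepProd_mulVec_stateVec hsol, neg_add_cancel] at h1
    rw [zero_add] at h2
    rw [sub_mulVec, h1, h2]
    simp
  have htrB : Tendsto (fun n => (stepProd V E (p n) (-p n)).trace) atTop (nhds 0) := by
    rw [tendsto_zero_iff_norm_tendsto_zero] at hleft ⊢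
    simp only [norm_smul] at hleft
    simpa [mul_assoc, mul_inv_cancel₀ (norm_ne_zero_iff.mpr hne)] using
      hleft.mul_const ‖stateVec u 0‖⁻¹
  have htrA : Tendsto (fun n => (stepProd V E (p n) 0).trace) atTop (nhds 0) := by
    have h : Tendsto (fun n => (stepProd V E (p n) 0 - stepProd V E (p n) (-p n)).trace)
        atTop (nhds 0) :=
      squeeze_zero_norm (fun n => norm_trace_fin_two_le _) (by simpa using hB.const_mul 2)
    simpa [trace_sub] using h.add htrB
  have hright : Tendsto (fun _ : ℕ => stateVec u 0) atTop (nhds 0) := by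
    have h := ((htrA.smul hU1).sub hU2).add (hmul hA hU1.norm)
    simp only [smul_zero, sub_zero, add_zero] at h
    refine h.congr fun n => ?_
    have h1 := hcayley (p n) 0 (stateVec u 0)
    have h2 := stepProd_mulVec_stateVec hsol (p n) (p n)
    rw [stepProd_mulVec_stateVec hsol, zero_add] at h1
    rw [sub_mulVec, h1, h2]
    simp
  exact hne (tendsto_nhds_unique tendsto_const_nhds hright)

/-- An `e^{-γ|q|}`-repetition with period `q` is also one with period `|q|`. -/
theorem abs_sub_natAbs_le {V : ℤ → ℝ} {q : ℤ} {δ : ℝ} (h : ∀ k : ℤ, |V (q + k) - V k| ≤ δ)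
    (k : ℤ) : |V (q.natAbs + k) - V k| ≤ δ := by
  rcases Int.natAbs_eq q with hq | hq
  · rw [← hq]
    exact h k
  · have := h (q.natAbs + k)
    rwa [show q + (q.natAbs + k) = k by omega, abs_sub_comm] at this

/-- Sharp Gordon's lemma (Theorem 1 of the paper): for a bounded potential with
`γ`-repetitions, if `γ > 𝓛(E)` then `Hu = Eu` has no nonzero `ℓ²(ℤ)` solution. -/
theorem no_eigenvalues_of_repetitions
    (V : ℤ → ℝ) (hV : ∃ M : ℝ, ∀ k : ℤ, |V k| ≤ M)
    (γ : ℝ) (hγ : 0 < γ)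
    (kseq : ℕ → ℤ)
    (hk : Tendsto kseq atTop atTop ∨ Tendsto kseq atTop atBot)
    (hrep : ∀ (n : ℕ) (k : ℤ),
      |V (kseq n + k) - V k| ≤ Real.exp (-γ * |(kseq n : ℝ)|))
    (E : ℂ) (hE : transferExp V E < (γ : EReal))
    (u : ℤ → ℂ)
    (hsol : ∀ k : ℤ, u (k + 1) + u (k - 1) + (V k : ℂ) * u k = E * u k)
    (hl2 : Summable fun k : ℤ => ‖u k‖ ^ 2) :
    u = 0 := by
  set p : ℕ → ℕ := fun n => (kseq n).natAbs with hpdef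
  have hp : Tendsto p atTop atTop := by
    refine tendsto_atTop.mpr fun b => ?_
    rcases hk with hk | hk
    · filter_upwards [hk.eventually_ge_atTop (b : ℤ)] with n hn
      simp only [hpdef]
      omega
    · filter_upwards [hk.eventually_le_atBot (-b : ℤ)] with n hn
      simp only [hpdef]
      omega
  have hper : ∀ (n : ℕ) (k : ℤ), |V (p n + k) - V k| ≤ Real.exp (-γ * p n) := fun n => by
    have h := abs_sub_natAbs_le (hrep n)
    rwa [← Int.cast_abs, ← Nat.cast_natAbs] at h
  obtain ⟨L, hL1, hL2⟩ := EReal.lt_iff_exists_real_btwn.mp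
    (max_lt hE (EReal.coe_pos.mpr hγ))
  have hL : 0 ≤ L := EReal.coe_nonneg.mp ((le_max_right _ _).trans hL1.le)
  have hLγ : L < γ := EReal.coe_lt_coe_iff.mp hL2
  obtain ⟨C, hC⟩ := exists_norm_stepProd_le hV hL ((le_max_left _ _).trans_lt hL1)
  have hdecay : Tendsto (fun n => (p n : ℝ) * C ^ 2 * Real.exp (L * p n) * Real.exp (-γ * p n))
      atTop (nhds 0) := by
    have h := ((tendsto_rpow_mul_exp_neg_mul_atTop_nhds_zero 1 (γ - L) (by linarith)).comp
      ((tendsto_natCast_atTop_atTop (R := ℝ)).comp hp)).const_mul (C ^ 2)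
    rw [mul_zero] at h
    refine h.congr fun n => ?_
    simp only [Function.comp_apply, Real.rpow_one]
    rw [mul_assoc _ (Real.exp _), ← Real.exp_add]
    ring_nf
  refine eq_zero_of_stateVec_zero hsol (stateVec_zero_eq_zero (p := p) hsol
    (tendsto_stateVec (tendsto_cofinite_of_summable_norm_sq hl2)) hp ?_ ?_)
  · refine squeeze_zero (fun _ => norm_nonneg _)
      (fun n => norm_stepProd_sub_le hL hC (fun i => ?_) (p n)) hdecay
    simpa using hper n i
  · refine squeeze_zero (fun _ => norm_nonneg _)
      (fun n => norm_stepProd_sub_le hL hC (fun i => ?_) (p n)) hdecay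
    simpa using hper n (-p n + i)
end
end

section
/- Let α ∈ ℝ be irrational, θ ∈ ℝ, and let v : ℝ/ℤ → ℝ be κ-Hölder continuous for some κ > 0. Consider the quasi-periodic Schrödinger operator (H_{v,α,θ}u)(k) = u(k+1) + u(k-1) + v(θ + kα)u(k) on ℓ²(ℤ), with potential V(k) = v(θ + kα). If E ∈ ℂ satisfies 𝓛(E) < κ·β(α), then H_{v,α,θ}u = Eu has no nonzero solution u ∈ ℓ²(ℤ). In particular, H_{v,α,θ} has no eigenvalues in the regime {E : 𝓛(E) < κβ(α)}. -/
open Filter Matrix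

noncomputable section

attribute [local instance] Matrix.linftyOpNormedRing

theorem norm_trace_le_two_mul_norm (A : Matrix (Fin 2) (Fin 2) ℂ) : ‖A.trace‖ ≤ 2 * ‖A‖ := by
  have hrow : ∀ i, ‖A i 0‖ + ‖A i 1‖ ≤ ‖A‖ := fun i => by
    have h : ∑ j, ‖A i j‖₊ ≤ ‖A‖₊ := by
      rw [Matrix.linfty_opNNNorm_def]
      exact Finset.le_sup (f := fun i => ∑ j, ‖A i j‖₊) (Finset.mem_univ i)
    rw [Fin.sum_univ_two] at h
    exact_mod_cast h
  rw [Matrix.trace_fin_two]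
  linarith [norm_add_le (A 0 0) (A 1 1), hrow 0, hrow 1, norm_nonneg (A 0 1), norm_nonneg (A 1 0)]

theorem mulVec_mulVec_add_self {A : Matrix (Fin 2) (Fin 2) ℂ} (hA : A.det = 1)
    (x : Fin 2 → ℂ) : A *ᵥ (A *ᵥ x) + x = A.trace • (A *ᵥ x) := by
  rw [Matrix.det_fin_two] at hA
  ext i
  fin_cases i <;>
    simp [Matrix.trace_fin_two]
  · linear_combination (-x 0) * hA
  · linear_combination (-x 1) * hA

/-- Three-block Gordon estimate: `y, x, A x, B A x` are the values of a solution at the ends of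
three consecutive blocks whose transfer matrices `C, A, B` differ by at most `δ`. -/
theorem norm_le_of_three_blocks {A B C : Matrix (Fin 2) (Fin 2) ℂ} {δ : ℝ}
    (hA : A.det = 1) (hC : C.det = 1) (hBA : ‖B - A‖ ≤ δ) (hAC : ‖A - C‖ ≤ δ)
    {x y : Fin 2 → ℂ} (hxy : C *ᵥ y = x) :
    ‖x‖ ≤ (1 + 3 * δ) * ‖A *ᵥ x‖ + ‖B *ᵥ (A *ᵥ x)‖ + ‖y‖ + δ * ‖x‖ := by
  have hδ : 0 ≤ δ := (norm_nonneg _).trans hBA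
  have hx := norm_nonneg x
  have hAx := norm_nonneg (A *ᵥ x)
  rcases le_total ‖C.trace‖ 1 with h | h
  · have htr : ‖A.trace‖ ≤ 1 + 2 * δ := by
      have h1 : ‖A.trace - C.trace‖ ≤ 2 * ‖A - C‖ := by
        rw [← Matrix.trace_sub]; exact norm_trace_le_two_mul_norm _
      linarith [norm_le_norm_add_norm_sub' A.trace C.trace]
    have key : x = A.trace • (A *ᵥ x) - B *ᵥ (A *ᵥ x) + (B - A) *ᵥ (A *ᵥ x) := by
      rw [← mulVec_mulVec_add_self hA, Matrix.sub_mulVec]; abel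
    have h1 : ‖x‖ ≤ ‖A.trace‖ * ‖A *ᵥ x‖ + ‖B *ᵥ (A *ᵥ x)‖ + ‖B - A‖ * ‖A *ᵥ x‖ := by
      conv_lhs => rw [key]
      refine (norm_add_le _ _).trans (add_le_add ((norm_sub_le _ _).trans ?_)
        (Matrix.linfty_opNorm_mulVec _ _))
      rw [norm_smul]
    have h2 := mul_le_mul_of_nonneg_right htr hAx
    have h3 := mul_le_mul_of_nonneg_right hBA hAx
    nlinarith [norm_nonneg y, mul_nonneg hδ hx]
  · have key : C.trace • x = A *ᵥ x - (A - C) *ᵥ x + y := by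
      have := mulVec_mulVec_add_self hC y
      rw [hxy] at this
      rw [← this, Matrix.sub_mulVec]; abel
    have h1 : ‖C.trace‖ * ‖x‖ ≤ ‖A *ᵥ x‖ + ‖A - C‖ * ‖x‖ + ‖y‖ := by
      rw [← norm_smul, key]
      exact (norm_add_le _ _).trans (add_le_add_left ((norm_sub_le _ _).trans
        (add_le_add_right (Matrix.linfty_opNorm_mulVec _ _) _)) _)
    have h2 := mul_le_mul_of_nonneg_right h hx
    have h3 := mul_le_mul_of_nonneg_right hAC hx
    nlinarith [norm_nonneg (B *ᵥ (A *ᵥ x)), mul_nonneg hδ hAx]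

theorem transferFwd_self (V : ℤ → ℝ) (E : ℂ) (s : ℤ) : transferFwd V E s s = 1 := by
  simp [transferFwd]

theorem transferFwd_add_natCast (V : ℤ → ℝ) (E : ℂ) (s : ℤ) (n : ℕ) :
    transferFwd V E (s + n) s
      = ((List.range n).map fun i : ℕ => oneStep V E (s + n - 1 - i)).prod := by
  have h : (s + (n : ℤ) - s).toNat = n := by omega
  simp only [transferFwd, h, List.bind_eq_flatMap, List.pure_def, ← List.map_eq_flatMap,
    List.map_map, Function.comp_def]

theorem transferFwd_add_natCast_succ (V : ℤ → ℝ) (E : ℂ) (s : ℤ) (n : ℕ) :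
    transferFwd V E (s + (n + 1 : ℕ)) s
      = oneStep V E (s + n) * transferFwd V E (s + n) s := by
  rw [transferFwd_add_natCast, transferFwd_add_natCast, List.range_succ_eq_map, List.map_cons,
    List.prod_cons, List.map_map]
  congr 2
  · push_cast; ring
  · refine List.map_congr_left fun i _ => ?_
    simp only [Function.comp_apply]
    congr 1
    push_cast; ring

theorem det_transferFwd (V : ℤ → ℝ) (E : ℂ) (s : ℤ) (n : ℕ) :
    (transferFwd V E (s + n) s).det = 1 := by
  induction n with
  | zero => simp [transferFwd_self]
  | succ n ih =>
    rw [transferFwd_add_natCast_succ, Matrix.det_mul, ih, oneStep, Matrix.det_fin_two_of]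
    ring

theorem transferFwd_mulVec {V : ℤ → ℝ} {E : ℂ} {u : ℤ → ℂ}
    (hsol : ∀ k : ℤ, u (k + 1) + u (k - 1) + (V k : ℂ) * u k = E * u k) (s : ℤ) (n : ℕ) :
    transferFwd V E (s + n) s *ᵥ ![u s, u (s - 1)] = ![u (s + n), u (s + n - 1)] := by
  induction n with
  | zero => simp [transferFwd_self]
  | succ n ih =>
    rw [transferFwd_add_natCast_succ, ← Matrix.mulVec_mulVec, ih, oneStep]
    have h1 : s + ((n + 1 : ℕ) : ℤ) = s + n + 1 := by push_cast; ring
    rw [h1, add_sub_cancel_right]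
    ext i
    fin_cases i
    · simp [Matrix.mulVec, dotProduct, Fin.sum_univ_two]
      linear_combination -hsol (s + n)
    · simp [Matrix.mulVec, dotProduct, Fin.sum_univ_two]

theorem transferFwd_sub_eq_sum (V : ℤ → ℝ) (E : ℂ) (s t : ℤ) (n : ℕ) :
    transferFwd V E (t + n) t - transferFwd V E (s + n) s
      = ∑ j ∈ Finset.range n, transferFwd V E (t + j + 1 + (n - 1 - j : ℕ)) (t + j + 1)
          * (oneStep V E (t + j) - oneStep V E (s + j)) * transferFwd V E (s + j) s := by
  induction n with
  | zero => simp [transferFwd_self]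
  | succ n ih =>
    rw [Finset.sum_range_succ, Nat.add_sub_cancel, Nat.sub_self, Nat.cast_zero,
      add_zero, transferFwd_self, one_mul]
    have hsum : ∑ j ∈ Finset.range n, transferFwd V E (t + j + 1 + (n - j : ℕ)) (t + j + 1)
          * (oneStep V E (t + j) - oneStep V E (s + j)) * transferFwd V E (s + j) s
        = oneStep V E (t + n) * (transferFwd V E (t + n) t - transferFwd V E (s + n) s) := by
      rw [ih, Finset.mul_sum]
      refine Finset.sum_congr rfl fun j hj => ?_
      have hj' := Finset.mem_range.1 hj
      have h1 : n - j = (n - 1 - j) + 1 := by omega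
      have h2 : t + (j : ℤ) + 1 + ((n - 1 - j : ℕ) : ℤ) = t + n := by omega
      rw [h1, transferFwd_add_natCast_succ, h2]
      simp only [mul_assoc]
    rw [hsum, transferFwd_add_natCast_succ, transferFwd_add_natCast_succ]
    noncomm_ring

theorem norm_oneStep_sub (V : ℤ → ℝ) (E : ℂ) (s t : ℤ) :
    ‖oneStep V E t - oneStep V E s‖ ≤ |V t - V s| := by
  rw [← coe_nnnorm, Matrix.linfty_opNNNorm_def, ← Real.norm_eq_abs, ← coe_nnnorm,
    NNReal.coe_le_coe]
  refine Finset.sup_le fun i _ => ?_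
  rw [← NNReal.coe_le_coe]
  fin_cases i
  · simp only [oneStep, Fin.sum_univ_two, Matrix.sub_apply]
    simp
    rw [← Complex.ofReal_sub, Complex.norm_real, Real.norm_eq_abs, abs_sub_comm]
  · simp [oneStep]

theorem norm_transferFwd_sub_le {V : ℤ → ℝ} {E : ℂ} {K a η : ℝ}
    (hK : ∀ (s : ℤ) (n : ℕ), ‖transferFwd V E (s + n) s‖ ≤ K * Real.exp (a * n))
    {s t : ℤ} (hη : ∀ j : ℕ, |V (t + j) - V (s + j)| ≤ η) (n : ℕ) :
    ‖transferFwd V E (t + n) t - transferFwd V E (s + n) s‖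
      ≤ n * (K ^ 2 * Real.exp (-a) * Real.exp (a * n) * η) := by
  rw [transferFwd_sub_eq_sum]
  have hbound : ∀ j ∈ Finset.range n,
      ‖transferFwd V E (t + j + 1 + (n - 1 - j : ℕ)) (t + j + 1)
          * (oneStep V E (t + j) - oneStep V E (s + j)) * transferFwd V E (s + j) s‖
        ≤ K ^ 2 * Real.exp (-a) * Real.exp (a * n) * η := by
    intro j hj
    have hj' := Finset.mem_range.1 hj
    have hcast : ((n - 1 - j : ℕ) : ℝ) = n - 1 - j := by
      rw [Nat.sub_sub, Nat.cast_sub (by omega)]; push_cast; ring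
    have hexp : Real.exp (a * (n - 1 - j : ℕ)) * Real.exp (a * j)
        = Real.exp (-a) * Real.exp (a * n) := by
      rw [← Real.exp_add, ← Real.exp_add, hcast]; ring_nf
    calc _ ≤ ‖transferFwd V E (t + j + 1 + (n - 1 - j : ℕ)) (t + j + 1)‖
          * ‖oneStep V E (t + j) - oneStep V E (s + j)‖ * ‖transferFwd V E (s + j) s‖ :=
          (norm_mul_le _ _).trans (mul_le_mul_of_nonneg_right (norm_mul_le _ _) (norm_nonneg _))
      _ ≤ K * Real.exp (a * (n - 1 - j : ℕ)) * η * (K * Real.exp (a * j)) := by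
          have h1 := hK (t + j + 1) (n - 1 - j)
          have h2 := hK s j
          have h3 := (norm_oneStep_sub V E (s + j) (t + j)).trans (hη j)
          have h4 := (norm_nonneg _).trans h1
          have h5 := (norm_nonneg _).trans h3
          gcongr
      _ = K ^ 2 * (Real.exp (a * (n - 1 - j : ℕ)) * Real.exp (a * j)) * η := by ring
      _ = _ := by rw [hexp]; ring
  refine (norm_sum_le_of_le _ hbound).trans ?_
  simp

/-- A bound for all large lengths, uniform in the base point, extends to all lengths when the
one-step matrices are bounded. -/
theorem exists_norm_transferFwd_le {V : ℤ → ℝ} {E : ℂ} {M a : ℝ}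
    (hM : ∀ k, ‖oneStep V E k‖ ≤ M)
    (ha : ∀ᶠ n : ℕ in atTop, ∀ s : ℤ, ‖transferFwd V E (s + n) s‖ ≤ Real.exp (a * n)) :
    ∃ K : ℝ, ∀ (s : ℤ) (n : ℕ), ‖transferFwd V E (s + n) s‖ ≤ K * Real.exp (a * n) := by
  have hM0 : 0 ≤ M := (norm_nonneg _).trans (hM 0)
  have hpow : ∀ (s : ℤ) (n : ℕ), ‖transferFwd V E (s + n) s‖ ≤ M ^ n := by
    intro s n
    induction n with
    | zero => simp [transferFwd_self]
    | succ n ih =>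
      rw [transferFwd_add_natCast_succ, pow_succ']
      exact (norm_mul_le _ _).trans (mul_le_mul (hM _) ih (norm_nonneg _) hM0)
  obtain ⟨N, hN⟩ := eventually_atTop.1 ha
  have hterm : ∀ n : ℕ, 0 ≤ M ^ n * Real.exp (-(a * n)) := fun n => by positivity
  have hsum0 : 0 ≤ ∑ n ∈ Finset.range N, M ^ n * Real.exp (-(a * n)) :=
    Finset.sum_nonneg fun n _ => hterm n
  refine ⟨1 + ∑ n ∈ Finset.range N, M ^ n * Real.exp (-(a * n)), fun s n => ?_⟩
  rcases lt_or_ge n N with h | h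
  · have h1 := Finset.single_le_sum (f := fun n : ℕ => M ^ n * Real.exp (-(a * n)))
      (fun n _ => hterm n) (Finset.mem_range.2 h)
    calc _ ≤ M ^ n := hpow s n
      _ = M ^ n * Real.exp (-(a * n)) * Real.exp (a * n) := by
          rw [mul_assoc, ← Real.exp_add]; simp
      _ ≤ _ := by
          refine mul_le_mul_of_nonneg_right ?_ (Real.exp_pos _).le
          linarith
  · refine (hN n h s).trans (le_mul_of_one_le_left (Real.exp_pos _).le ?_)
    linarith

theorem eventually_norm_transferFwd_le {V : ℤ → ℝ} {E : ℂ} {a : ℝ}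
    (h : transferExp V E < (a : EReal)) :
    ∀ᶠ n : ℕ in atTop, ∀ s : ℤ, ‖transferFwd V E (s + n) s‖ ≤ Real.exp (a * n) := by
  filter_upwards [eventually_lt_of_limsup_lt h, eventually_gt_atTop 0] with n hn hn0 s
  have h1 : Real.log ‖transfer V E ((n : ℤ) + s) s‖ / (n : ℝ) < a :=
    EReal.coe_lt_coe_iff.1 ((le_iSup (fun j : ℤ =>
      ((Real.log ‖transfer V E ((n : ℤ) + j) j‖ / (n : ℝ) : ℝ) : EReal)) s).trans_lt hn)
  rw [transfer, if_pos (by omega), add_comm (n : ℤ) s, div_lt_iff₀ (by exact_mod_cast hn0)] at h1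
  exact (Real.le_exp_log _).trans (Real.exp_le_exp.2 h1.le)

theorem frequently_abs_sub_round_rpow_le {α : ℝ} (hα : Irrational α) {κ c : ℝ} (hκ : 0 < κ)
    (h : (c : EReal) < (κ : EReal) * beta α) :
    ∃ᶠ q : ℕ in atTop, |(q : ℝ) * α - round ((q : ℝ) * α)| ^ κ ≤ Real.exp (-(c * q)) := by
  have hb : ((c / κ : ℝ) : EReal) < beta α := by
    by_contra! hle
    refine absurd h (not_lt.2 ?_)
    calc (κ : EReal) * beta α ≤ (κ : EReal) * ((c / κ : ℝ) : EReal) :=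
          mul_le_mul_of_nonneg_left hle (by exact_mod_cast hκ.le)
      _ = c := by rw [← EReal.coe_mul, mul_div_cancel₀ _ hκ.ne']
  refine ((frequently_lt_of_lt_limsup (by isBoundedDefault) hb).and_eventually
    (eventually_gt_atTop 0)).mono ?_
  rintro q ⟨hq, hq0⟩
  have hq' : (0 : ℝ) < q := by exact_mod_cast hq0
  have hpos : 0 < |(q : ℝ) * α - round ((q : ℝ) * α)| := by
    rw [abs_pos, sub_ne_zero]
    exact (hα.natCast_mul hq0.ne').ne_int _
  have h1 := EReal.coe_lt_coe_iff.1 hq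
  rw [div_lt_div_iff₀ hκ hq'] at h1
  rw [Real.rpow_def_of_pos hpos, Real.exp_le_exp]
  linarith

theorem eq_zero_of_initial_zero {V : ℤ → ℝ} {E : ℂ} {u : ℤ → ℂ}
    (hsol : ∀ k : ℤ, u (k + 1) + u (k - 1) + (V k : ℂ) * u k = E * u k)
    (h0 : u 0 = 0) (h1 : u (-1) = 0) : u = 0 := by
  have key : ∀ k : ℤ, u k = 0 ∧ u (k - 1) = 0 := by
    intro k
    induction k using Int.induction_on with
    | zero => exact ⟨h0, by simpa using h1⟩
    | succ k ih =>
      have := hsol k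
      rw [ih.1, ih.2] at this
      exact ⟨by simpa using this, by simpa using ih.1⟩
    | pred k ih =>
      have := hsol (-k - 1)
      rw [sub_add_cancel, ih.1, ih.2] at this
      exact ⟨ih.2, by simpa using this⟩
  exact funext fun k => (key k).1

theorem tendsto_pair_of_summable_sq {u : ℤ → ℂ} (hl2 : Summable fun k : ℤ => ‖u k‖ ^ 2)
    {f : ℕ → ℤ} (hf : Function.Injective f) :
    Tendsto (fun n => ‖![u (f n), u (f n - 1)]‖) atTop (nhds 0) := by
  have hu : Tendsto u cofinite (nhds 0) := by
    rw [tendsto_zero_iff_norm_tendsto_zero]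
    simpa using hl2.tendsto_cofinite_zero.sqrt
  have hg : Function.Injective fun n => f n - 1 := fun a b h => hf (by simpa using h)
  have h1 := hu.comp hf.tendsto_cofinite
  have h2 := hu.comp hg.tendsto_cofinite
  rw [Nat.cofinite_eq_atTop] at h1 h2
  rw [← tendsto_zero_iff_norm_tendsto_zero, tendsto_pi_nhds]
  intro i
  fin_cases i
  · simpa [Function.comp_def] using h1
  · simpa [Function.comp_def] using h2

/-- Corollary 1: for a quasi-periodic potential given by a `κ`-Hölder continuous sampling
function `v : ℝ/ℤ → ℝ`, the operator `H_{v,α,θ}` has no eigenvalues in the regime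
`{E : 𝓛(E) < κ·β(α)}`. -/
theorem no_eigenvalues_quasiperiodic_holder
    (α : ℝ) (hα : Irrational α) (θ : ℝ)
    (κ : ℝ) (hκ : 0 < κ)
    (v : AddCircle (1 : ℝ) → ℝ)
    (hHolder : ∃ C : ℝ, ∀ x y : AddCircle (1 : ℝ), |v x - v y| ≤ C * dist x y ^ κ)
    (E : ℂ)
    (hE : transferExp (fun k : ℤ => v (↑(θ + (k : ℝ) * α))) E < (κ : EReal) * beta α)
    (u : ℤ → ℂ)
    (hsol : ∀ k : ℤ,
      u (k + 1) + u (k - 1) + ((v (↑(θ + (k : ℝ) * α)) : ℝ) : ℂ) * u k = E * u k)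
    (hl2 : Summable fun k : ℤ => ‖u k‖ ^ 2) :
    u = 0 := by
  obtain ⟨C, hC⟩ := hHolder
  set V : ℤ → ℝ := fun k => v (↑(θ + (k : ℝ) * α)) with hV
  obtain ⟨a, ha, h⟩ := EReal.lt_iff_exists_real_btwn.1 hE
  obtain ⟨c, hac, hc⟩ := EReal.lt_iff_exists_real_btwn.1 h
  replace hac : a < c := EReal.coe_lt_coe_iff.1 hac
  have hM : ∀ k, ‖oneStep V E k‖ ≤ ‖oneStep V E 0‖ + |C| := by
    intro k
    have hd : dist (↑(θ + (k : ℝ) * α) : AddCircle (1 : ℝ)) ↑(θ + ((0 : ℤ) : ℝ) * α) ≤ 1 := by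
      rw [dist_eq_norm]
      exact (AddCircle.norm_le_half_period 1 one_ne_zero).trans (by norm_num)
    have h1 : |V k - V 0| ≤ |C| := by
      refine (hC _ _).trans ((mul_le_mul_of_nonneg_right (le_abs_self C) (by positivity)).trans ?_)
      exact mul_le_of_le_one_right (abs_nonneg C) (Real.rpow_le_one dist_nonneg hd hκ.le)
    linarith [norm_le_norm_add_norm_sub' (oneStep V E k) (oneStep V E 0), norm_oneStep_sub V E 0 k]
  obtain ⟨K, hK⟩ := exists_norm_transferFwd_le hM (eventually_norm_transferFwd_le ha)
  have hshift : ∀ (q : ℕ) (k : ℤ),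
      |V (k + q) - V k| ≤ |C| * |(q : ℝ) * α - round ((q : ℝ) * α)| ^ κ := by
    intro q k
    refine (hC _ _).trans ?_
    rw [dist_eq_norm, ← AddCircle.coe_sub, UnitAddCircle.norm_eq]
    have : θ + ((k + q : ℤ) : ℝ) * α - (θ + (k : ℝ) * α) = q * α := by push_cast; ring
    rw [this]
    exact mul_le_mul_of_nonneg_right (le_abs_self C) (by positivity)
  set D : ℝ := K ^ 2 * Real.exp (-a) * |C| with hD
  set δ : ℕ → ℝ := fun q => D * (q * Real.exp (-((c - a) * q))) with hδ
  have hδ0 : Tendsto δ atTop (nhds 0) := by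
    have h1 := (Real.tendsto_pow_mul_exp_neg_atTop_nhds_zero 1).comp
      ((tendsto_natCast_atTop_atTop (R := ℝ)).const_mul_atTop (sub_pos.2 hac))
    have h2 := h1.const_mul (D / (c - a))
    rw [mul_zero] at h2
    refine h2.congr fun q => ?_
    have : c - a ≠ 0 := (sub_pos.2 hac).ne'
    simp only [Function.comp_apply, pow_one, hδ]
    field_simp
  set U : ℤ → Fin 2 → ℂ := fun k => ![u k, u (k - 1)] with hU
  have hfreq : ∃ᶠ q : ℕ in atTop, ‖U 0‖ ≤
      (1 + 3 * δ q) * ‖U q‖ + ‖U (q + q)‖ + ‖U (-q)‖ + δ q * ‖U 0‖ := by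
    refine (frequently_abs_sub_round_rpow_le hα hκ hc).mono fun q hq => ?_
    have hη : ∀ k : ℤ, |V (k + q) - V k| ≤ |C| * Real.exp (-(c * q)) := fun k =>
      (hshift q k).trans (mul_le_mul_of_nonneg_left hq (abs_nonneg C))
    have hclose : ∀ s : ℤ,
        ‖transferFwd V E (s + q + q) (s + q) - transferFwd V E (s + q) s‖ ≤ δ q := by
      intro s
      refine (norm_transferFwd_sub_le hK (η := |C| * Real.exp (-(c * q)))
        (fun j => ?_) q).trans_eq ?_
      · rw [add_right_comm]; exact hη _
      · have : Real.exp (-((c - a) * q)) = Real.exp (a * q) * Real.exp (-(c * q)) := by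
          rw [← Real.exp_add]; ring_nf
        simp only [hδ, hD, this]; ring
    have h1 := transferFwd_mulVec hsol 0 q
    have h2 := transferFwd_mulVec hsol q q
    have h3 := transferFwd_mulVec hsol (-q) q
    have hA := det_transferFwd V E 0 q
    have hB := hclose 0
    have hC' := hclose (-q)
    have hdC := det_transferFwd V E (-q) q
    rw [zero_add] at h1 hA hB
    rw [neg_add_cancel] at h3 hC' hdC
    rw [zero_add] at hC'
    have := norm_le_of_three_blocks hA hdC hB hC' h3
    rw [h1, h2] at this
    exact this
  have hlim : Tendsto (fun q : ℕ =>
      (1 + 3 * δ q) * ‖U q‖ + ‖U (q + q)‖ + ‖U (-q)‖ + δ q * ‖U 0‖) atTop (nhds 0) := by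
    have h1 := tendsto_pair_of_summable_sq hl2 (f := fun q : ℕ => (q : ℤ))
      fun a b h => by simpa using h
    have h2 := tendsto_pair_of_summable_sq hl2 (f := fun q : ℕ => (q : ℤ) + q)
      fun a b h => by simp only at h; omega
    have h3 := tendsto_pair_of_summable_sq hl2 (f := fun q : ℕ => -(q : ℤ))
      fun a b h => by simpa using h
    simpa using ((((hδ0.const_mul 3).const_add 1).mul h1).add h2).add h3 |>.add
      (hδ0.mul_const ‖U 0‖)
  have hU0 : U 0 = 0 := norm_le_zero_iff.1 (ge_of_tendsto_of_frequently hlim hfreq)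
  exact eq_zero_of_initial_zero hsol (by simpa [hU] using congrFun hU0 0)
    (by simpa [hU] using congrFun hU0 1)
end
end

section
/- Let E ∈ ℂ, δ > 0, and let V, V' : ℤ → ℝ be potentials with |V(k) − V'(k)| ≤ δ for all k ∈ ℤ. Suppose u, u' ∈ ℓ²(ℤ) are solutions of u(k+1) + u(k−1) + V(k)u(k) = E u(k) and u'(k+1) + u'(k−1) + V'(k)u'(k) = E u'(k) respectively, normalized so that ‖u‖_{ℓ²} = ‖u'‖_{ℓ²} = 1. Then for all k ∈ ℤ and all m ≥ 0, |W(u,u')(k+m) − W(u,u')(k−1)| ≤ δ. -/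
noncomputable section

/-- Wronskian of two sequences: `W(f,g)(k) = f(k+1)g(k) − f(k)g(k+1)`. -/
def wronskian (f g : ℤ → ℂ) (k : ℤ) : ℂ :=
  f (k + 1) * g k - f k * g (k + 1)

theorem wronskian_sub_wronskian_pred {E : ℂ} {V V' : ℤ → ℝ} {u u' : ℤ → ℂ}
    (hu : ∀ k : ℤ, u (k + 1) + u (k - 1) + (V k : ℂ) * u k = E * u k)
    (hu' : ∀ k : ℤ, u' (k + 1) + u' (k - 1) + (V' k : ℂ) * u' k = E * u' k) (k : ℤ) :
    wronskian u u' k - wronskian u u' (k - 1) = ((V' k - V k : ℝ) : ℂ) * (u k * u' k) := by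
  simp only [wronskian, sub_add_cancel]
  push_cast
  linear_combination u' k * hu k - u k * hu' k

theorem norm_wronskian_sub_le_sum {E : ℂ} {δ : ℝ} {V V' : ℤ → ℝ}
    (hVV' : ∀ k : ℤ, |V k - V' k| ≤ δ) {u u' : ℤ → ℂ}
    (hu : ∀ k : ℤ, u (k + 1) + u (k - 1) + (V k : ℂ) * u k = E * u k)
    (hu' : ∀ k : ℤ, u' (k + 1) + u' (k - 1) + (V' k : ℂ) * u' k = E * u' k)
    (k : ℤ) (m : ℕ) :
    ‖wronskian u u' (k + m) - wronskian u u' (k - 1)‖ ≤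
      δ * ∑ i ∈ Finset.range (m + 1), ‖u (k + i)‖ * ‖u' (k + i)‖ := by
  have step (j : ℤ) :
      ‖wronskian u u' j - wronskian u u' (j - 1)‖ ≤ δ * (‖u j‖ * ‖u' j‖) := by
    rw [wronskian_sub_wronskian_pred hu hu', norm_mul, norm_mul, Complex.norm_real,
      Real.norm_eq_abs, abs_sub_comm]
    gcongr
    exact hVV' j
  induction m with
  | zero => simpa using step k
  | succ m ih =>
    have h := step (k + (m + 1 : ℕ))
    rw [show k + ((m + 1 : ℕ) : ℤ) - 1 = k + m by push_cast; ring] at h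
    rw [Finset.sum_range_succ, mul_add, add_comm (δ * _)]
    exact (norm_sub_le_norm_sub_add_norm_sub _ _ _).trans (add_le_add h ih)

/-- Estimate (2.7): for normalized `ℓ²` solutions of `δ`-close potentials,
`|W(u,u')(k+m) − W(u,u')(k−1)| ≤ δ` for all `k` and all `m ≥ 0`. -/
theorem wronskian_diff_le
    (E : ℂ) (δ : ℝ) (hδ : 0 < δ)
    (V V' : ℤ → ℝ) (hVV' : ∀ k : ℤ, |V k - V' k| ≤ δ)
    (u u' : ℤ → ℂ)
    (hu : ∀ k : ℤ, u (k + 1) + u (k - 1) + (V k : ℂ) * u k = E * u k)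
    (hu' : ∀ k : ℤ, u' (k + 1) + u' (k - 1) + (V' k : ℂ) * u' k = E * u' k)
    (hu2 : Summable fun k : ℤ => ‖u k‖ ^ 2)
    (hu'2 : Summable fun k : ℤ => ‖u' k‖ ^ 2)
    (hnu : ∑' k : ℤ, ‖u k‖ ^ 2 = 1)
    (hnu' : ∑' k : ℤ, ‖u' k‖ ^ 2 = 1) :
    ∀ (k : ℤ) (m : ℕ),
      ‖wronskian u u' (k + m) - wronskian u u' (k - 1)‖ ≤ δ := by
  intro k m
  have sum_le {v : ℤ → ℂ} (hv : Summable fun j : ℤ => ‖v j‖ ^ 2)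
      (hv1 : ∑' j : ℤ, ‖v j‖ ^ 2 = 1) :
      ∑ i ∈ Finset.range (m + 1), ‖v (k + i)‖ ^ 2 ≤ 1 := by
    have hinj : Function.Injective fun i : ℕ => k + (i : ℤ) := fun a b h => by
      simpa using h
    have h := hv.sum_le_tsum ((Finset.range (m + 1)).map ⟨_, hinj⟩) fun _ _ => by positivity
    rwa [Finset.sum_map, hv1] at h
  have hprod : ∑ i ∈ Finset.range (m + 1), ‖u (k + i)‖ * ‖u' (k + i)‖ ≤ 1 := by
    have h : ∑ i ∈ Finset.range (m + 1), 2 * (‖u (k + i)‖ * ‖u' (k + i)‖) ≤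
        ∑ i ∈ Finset.range (m + 1), (‖u (k + i)‖ ^ 2 + ‖u' (k + i)‖ ^ 2) :=
      Finset.sum_le_sum fun i _ => by
        linarith [two_mul_le_add_sq ‖u (k + i)‖ ‖u' (k + i)‖]
    rw [← Finset.mul_sum, Finset.sum_add_distrib] at h
    linarith [sum_le hu2 hnu, sum_le hu'2 hnu']
  exact (norm_wronskian_sub_le_sum hVV' hu hu' k m).trans
    (mul_le_of_le_one_right hδ.le hprod)
end
end

section
/- Let α ∈ ℝ be irrational with β(α) > 0, let v : ℝ/ℤ → ℝ be κ-Hölder continuous for some κ > 0, let θ ∈ ℝ, and set V(k) = v(θ + kα) for k ∈ ℤ. Then for every γ with 0 < γ < κβ(α), the potential V has γ-repetitions: there exists an increasing sequence k_n → +∞ such that |V(k_n + k) − V(k)| ≤ e^{−γ k_n} for all k ∈ ℤ and all n. -/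
open Filter Matrix

noncomputable section

attribute [local instance] Matrix.linftyOpNormedRing

/-- Translating by `m * α` moves every point of the circle by the distance of `m * α` to `ℤ`. -/
theorem dist_translate_mul (α θ : ℝ) (m k : ℤ) :
    dist ((θ + ((m + k : ℤ) : ℝ) * α : ℝ) : AddCircle (1 : ℝ)) ((θ + (k : ℝ) * α : ℝ)) =
      |(m : ℝ) * α - round ((m : ℝ) * α)| := by
  rw [dist_eq_norm, ← AddCircle.coe_sub, ← UnitAddCircle.norm_eq]
  congr 2
  push_cast
  ring

/-- Any `c < beta α` bounds infinitely often the exponential rate at which `k * α` approaches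
`ℤ`. -/
theorem frequently_abs_sub_round_le_exp {α c : ℝ} (h : (c : EReal) < beta α) :
    ∃ᶠ k : ℕ in atTop, |(k : ℝ) * α - round ((k : ℝ) * α)| ≤ Real.exp (-(c * k)) := by
  refine ((frequently_lt_of_lt_limsup (h := h)).and_eventually (eventually_gt_atTop 0)).mono ?_
  rintro k ⟨hk, hpos⟩
  have hk' : c < -Real.log |(k : ℝ) * α - round ((k : ℝ) * α)| / k := EReal.coe_lt_coe_iff.1 hk
  rw [lt_div_iff₀ (by exact_mod_cast hpos)] at hk'
  rcases (abs_nonneg ((k : ℝ) * α - round ((k : ℝ) * α))).eq_or_lt with h0 | h0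
  · exact h0 ▸ (Real.exp_pos _).le
  · exact (Real.log_le_iff_le_exp h0).1 (by linarith)

/-- A quasi-periodic potential with `κ`-Hölder sampling function has `γ`-repetitions
for every `0 < γ < κ·β(α)`. -/
theorem quasiperiodic_has_repetitions
    (α : ℝ) (hα : Irrational α) (hβ : 0 < beta α)
    (κ : ℝ) (hκ : 0 < κ)
    (v : AddCircle (1 : ℝ) → ℝ)
    (hHolder : ∃ C : ℝ, ∀ x y : AddCircle (1 : ℝ), |v x - v y| ≤ C * dist x y ^ κ)
    (θ : ℝ)
    (γ : ℝ) (hγ : 0 < γ) (hγβ : (γ : EReal) < (κ : EReal) * beta α) :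
    ∃ kseq : ℕ → ℤ, StrictMono kseq ∧ Filter.Tendsto kseq Filter.atTop Filter.atTop ∧
      ∀ (n : ℕ) (k : ℤ),
        |v (↑(θ + ((kseq n + k : ℤ) : ℝ) * α)) - v (↑(θ + (k : ℝ) * α))| ≤
          Real.exp (-γ * (kseq n : ℝ)) := by
  obtain ⟨C, hC⟩ := hHolder
  have hlt : ((γ / κ : ℝ) : EReal) < beta α := by
    by_contra! hle
    have h := mul_le_mul_of_nonneg_left hle (EReal.coe_nonneg.2 hκ.le)
    rw [← EReal.coe_mul, mul_div_cancel₀ γ hκ.ne'] at h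
    exact hγβ.not_ge h
  obtain ⟨c, hγc, hcβ⟩ := EReal.lt_iff_exists_real_btwn.1 hlt
  have hγc' : 0 < c * κ - γ := sub_pos.2 ((div_lt_iff₀ hκ).1 (EReal.coe_lt_coe_iff.1 hγc))
  have hlarge : ∀ᶠ k : ℕ in atTop, max C 0 ≤ Real.exp ((c * κ - γ) * k) :=
    (Real.tendsto_exp_atTop.comp
      (tendsto_natCast_atTop_atTop.const_mul_atTop hγc')).eventually_ge_atTop _
  obtain ⟨φ, hφ, hφ'⟩ := extraction_of_frequently_atTop
    ((frequently_abs_sub_round_le_exp hcβ).and_eventually hlarge)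
  refine ⟨fun n => (φ n : ℤ), fun a b hab => Int.ofNat_lt.2 (hφ hab),
    tendsto_natCast_atTop_atTop.comp hφ.tendsto_atTop, fun n k => (hC _ _).trans ?_⟩
  obtain ⟨hclose, hbig⟩ := hφ' n
  rw [dist_translate_mul, Int.cast_natCast]
  calc C * |(φ n : ℝ) * α - round ((φ n : ℝ) * α)| ^ κ
      ≤ max C 0 * |(φ n : ℝ) * α - round ((φ n : ℝ) * α)| ^ κ := by
        gcongr
        exact le_max_left _ _
    _ ≤ Real.exp ((c * κ - γ) * φ n) * Real.exp (-(c * φ n)) ^ κ := by gcongr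
    _ = Real.exp (-γ * φ n) := by
        rw [← Real.exp_mul, ← Real.exp_add]
        ring_nf
end
end
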